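/- With the operators Lₙ and aⱼ of the rank-one h = 2 twisted Sugawara construction on the twisted bosonic Fock space R = ℂ[t₁, t₃, t₅, …], one has [Lₙ, aⱼ] = −(j/2)·a_{j+2n} for all n ∈ ℤ and all odd integers j. -/

import Mathlib

open scoped BigOperators

/-- The index set of the variables: the positive odd integers. -/
abbrev OddIdx : Type := {j : ℤ // 0 < j ∧ Odd j}

/-- The twisted bosonic Fock space `R = ℂ[t₁, t₃, t₅, …]`, a polynomial ring in
variables indexed by the positive odd integers. -/
abbrev TwFockSpace : Type := MvPolynomial OddIdx ℂ

/-- The twisted Heisenberg operators: for odd `j > 0`, `a j = (j/2)·∂/∂tⱼ` and `a (−j)` is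
multiplication by `tⱼ`; the operator is zero for even indices. -/
noncomputable def twHeisOp (j : ℤ) : Module.End ℂ TwFockSpace :=
  if hodd : Odd j then
    if hpos : 0 < j then
      ((j : ℂ) / 2) • (MvPolynomial.pderiv (⟨j, hpos, hodd⟩ : OddIdx)).toLinearMap
    else
      LinearMap.mulLeft ℂ (MvPolynomial.X
        (⟨-j, by rcases hodd with ⟨k, hk⟩; omega, hodd.neg⟩ : OddIdx))
  else 0

/-- Normally ordered product `:aᵢaⱼ:`, the factor with the smaller (possibly negative)
index placed on the left. -/
noncomputable def twNormalOrd (i j : ℤ) : Module.End ℂ TwFockSpace :=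
  twHeisOp (min i j) * twHeisOp (max i j)

/-- The twisted Sugawara operator
`Lₙ = (1/2)·Σ_{i+j=2n, i,j odd} :aᵢaⱼ: + δ_{n,0}·(1/16)·id`; applied to any fixed
polynomial only finitely many summands are nonzero, so the sum is a well-defined finite
sum (formalized with `finsum`; the summands with even index vanish by definition). -/
noncomputable def twSugawaraOp (n : ℤ) : TwFockSpace → TwFockSpace :=
  fun p => (2 : ℂ)⁻¹ • ∑ᶠ i : ℤ, twNormalOrd i (2 * n - i) p
    + (if n = 0 then ((16 : ℂ)⁻¹ • p) else 0)

open MvPolynomial in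
theorem pderiv_pderiv_comm {σ R : Type*} [CommRing R] (i j : σ) (p : MvPolynomial σ R) :
    pderiv i (pderiv j p) = pderiv j (pderiv i p) := by
  classical
  have h : ⁅pderiv (R := R) i, pderiv (R := R) j⁆ = 0 := by
    refine derivation_ext fun k => ?_
    simp [Derivation.commutator_apply, pderiv_X, Pi.single_apply, apply_ite]
  have h' := DFunLike.congr_fun h p
  rwa [Derivation.commutator_apply, Derivation.zero_apply, sub_eq_zero] at h'

theorem twHeisOp_of_pos {j : ℤ} (hodd : Odd j) (hpos : 0 < j) (p : TwFockSpace) :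
    twHeisOp j p = ((j : ℂ) / 2) • MvPolynomial.pderiv (⟨j, hpos, hodd⟩ : OddIdx) p := by
  simp [twHeisOp, hodd, hpos]

theorem twHeisOp_of_neg {j : ℤ} (hodd : Odd j) (hneg : 0 < -j) (p : TwFockSpace) :
    twHeisOp j p = MvPolynomial.X (⟨-j, hneg, hodd.neg⟩ : OddIdx) * p := by
  simp [twHeisOp, hodd, show ¬ 0 < j by lia]

theorem twHeisOp_of_not_odd {j : ℤ} (h : ¬ Odd j) : twHeisOp j = 0 := by
  simp [twHeisOp, h]

/-- An annihilation operator and a creation operator satisfy the Heisenberg relation. -/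
theorem twHeisOp_pos_neg {i j : ℤ} (hi : Odd i) (hj : Odd j) (hi0 : 0 < i) (hj0 : 0 < -j)
    (p : TwFockSpace) :
    twHeisOp i (twHeisOp j p) - twHeisOp j (twHeisOp i p)
      = (if i = -j then (i : ℂ) / 2 else 0) • p := by
  classical
  simp only [twHeisOp_of_pos hi hi0, twHeisOp_of_neg hj hj0, Derivation.leibniz,
    MvPolynomial.pderiv_X, Pi.single_apply, Subtype.mk.injEq, smul_eq_mul, mul_smul_comm,
    smul_add]
  by_cases h : i = -j
  · simp [h]
  · simp [h, Ne.symm h]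

/-- The twisted Heisenberg relations. -/
theorem twHeisOp_commutator {i j : ℤ} (hj : Odd j) (p : TwFockSpace) :
    twHeisOp i (twHeisOp j p) - twHeisOp j (twHeisOp i p)
      = (if i = -j then (i : ℂ) / 2 else 0) • p := by
  by_cases hi : Odd i
  · have hi' : i ≠ 0 := by rintro rfl; simp at hi
    have hj' : j ≠ 0 := by rintro rfl; simp at hj
    rcases lt_or_gt_of_ne hi' with hi0 | hi0 <;> rcases lt_or_gt_of_ne hj' with hj0 | hj0
    · rw [if_neg (by lia)]
      simp only [twHeisOp_of_neg hi (neg_pos.2 hi0), twHeisOp_of_neg hj (neg_pos.2 hj0)]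
      rw [mul_left_comm, sub_self, zero_smul]
    · have h := twHeisOp_pos_neg hj hi hj0 (neg_pos.2 hi0) p
      rw [← neg_sub, h, ← neg_smul]
      congr 1
      by_cases hij : i = -j
      · simp [hij, neg_div]
      · rw [if_neg hij, if_neg (by lia), neg_zero]
    · exact twHeisOp_pos_neg hi hj hi0 (neg_pos.2 hj0) p
    · rw [if_neg (by lia)]
      simp only [twHeisOp_of_pos hi hi0, twHeisOp_of_pos hj hj0, Derivation.map_smul]
      rw [pderiv_pderiv_comm, smul_comm, sub_self, zero_smul]
  · have hij : i ≠ -j := by rintro rfl; exact hi hj.neg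
    simp [twHeisOp_of_not_odd hi, hij]

theorem exists_forall_lt_twHeisOp_eq_zero (p : TwFockSpace) :
    ∃ N : ℤ, ∀ m, N < m → twHeisOp m p = 0 := by
  obtain ⟨N, hN⟩ := (p.vars.image Subtype.val).bddAbove
  refine ⟨max N 0, fun m hm => ?_⟩
  by_cases hodd : Odd m
  · rw [twHeisOp_of_pos hodd (by lia), MvPolynomial.pderiv_eq_zero_of_notMem_vars, smul_zero]
    intro hmem
    have := hN (Finset.mem_coe.2 (Finset.mem_image_of_mem Subtype.val hmem))
    lia
  · simp [twHeisOp_of_not_odd hodd]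

theorem finite_support_twNormalOrd (n : ℤ) (p : TwFockSpace) :
    (Function.support fun i : ℤ => twNormalOrd i (2 * n - i) p).Finite := by
  obtain ⟨N, hN⟩ := exists_forall_lt_twHeisOp_eq_zero p
  refine (Set.finite_Icc (2 * n - N) N).subset fun i hi => ?_
  by_contra hmem
  rw [Set.mem_Icc] at hmem
  exact hi (by simp [twNormalOrd, hN (max i (2 * n - i)) (by lia)])

theorem twNormalOrd_commutator (i k : ℤ) {j : ℤ} (hj : Odd j) (p : TwFockSpace) :
    twNormalOrd i k (twHeisOp j p) - twHeisOp j (twNormalOrd i k p)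
      = (if i = -j then (i : ℂ) / 2 else 0) • twHeisOp k p
        + (if k = -j then (k : ℂ) / 2 else 0) • twHeisOp i p := by
  have key (a b : ℤ) : twHeisOp a (twHeisOp b (twHeisOp j p))
        - twHeisOp j (twHeisOp a (twHeisOp b p))
      = (if a = -j then (a : ℂ) / 2 else 0) • twHeisOp b p
        + (if b = -j then (b : ℂ) / 2 else 0) • twHeisOp a p := by
    rw [← twHeisOp_commutator hj, ← map_smul, ← twHeisOp_commutator hj, map_sub]
    abel
  simp only [twNormalOrd, Module.End.mul_apply]
  rcases le_total i k with h | h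
  · rw [min_eq_left h, max_eq_right h, key]
  · rw [min_eq_right h, max_eq_left h, key, add_comm]

/-- **The twisted Sugawara Virasoro action coincides with the canonical action on the
twisted Heisenberg:** `[Lₙ, aⱼ] = −(j/2)·a_{j+2n}` for all `n ∈ ℤ` and all odd `j`. -/
theorem twisted_sugawara_heisenberg_commutator (n j : ℤ) (hj : Odd j) (p : TwFockSpace) :
    twSugawaraOp n (twHeisOp j p) - twHeisOp j (twSugawaraOp n p)
      = (-(j : ℂ) / 2) • twHeisOp (j + 2 * n) p := by
  have hsum : (∑ᶠ i : ℤ, twNormalOrd i (2 * n - i) (twHeisOp j p))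
      - twHeisOp j (∑ᶠ i : ℤ, twNormalOrd i (2 * n - i) p)
      = (-(j : ℂ)) • twHeisOp (j + 2 * n) p := by
    have hfin := finite_support_twNormalOrd n p
    have hmap : twHeisOp j (∑ᶠ i : ℤ, twNormalOrd i (2 * n - i) p)
        = ∑ᶠ i : ℤ, twHeisOp j (twNormalOrd i (2 * n - i) p) :=
      (twHeisOp j).toAddMonoidHom.map_finsum hfin
    rw [hmap, ← finsum_sub_distrib (finite_support_twNormalOrd n _)
      (hfin.subset fun i hi h => hi (by simp [h]))]
    simp only [twNormalOrd_commutator _ _ hj]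
    have h₁ (i : ℤ) (hi : i ≠ -j) :
        (if i = -j then (i : ℂ) / 2 else 0) • twHeisOp (2 * n - i) p = 0 := by simp [hi]
    have h₂ (i : ℤ) (hi : i ≠ j + 2 * n) :
        (if 2 * n - i = -j then ((2 * n - i : ℤ) : ℂ) / 2 else 0) • twHeisOp i p = 0 := by
      rw [if_neg (by lia), zero_smul]
    rw [finsum_add_distrib
      ((Set.finite_singleton (-j)).subset fun i hi => by_contra fun h => hi (h₁ i h))
      ((Set.finite_singleton (j + 2 * n)).subset fun i hi => by_contra fun h => hi (h₂ i h)),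
      finsum_eq_single _ _ h₁, finsum_eq_single _ _ h₂, if_pos rfl, if_pos (by ring),
      show 2 * n - -j = j + 2 * n by ring, show 2 * n - (j + 2 * n) = -j by ring, ← add_smul]
    push_cast
    congr 1
    ring
  have hzero : twHeisOp j (if n = 0 then (16 : ℂ)⁻¹ • p else 0)
      = if n = 0 then (16 : ℂ)⁻¹ • twHeisOp j p else 0 := by
    split_ifs <;> simp
  rw [twSugawaraOp, twSugawaraOp, map_add, hzero, add_sub_add_right_eq_sub, map_smul,
    ← smul_sub, hsum, smul_smul]
  congr 1
  ring
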